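/- Let 1 < p < ∞ and δ > 1, and let s⁻ ∈ (−∞, 0) be the unique nonpositive solution of (1 − p s)^{p−1}/(1 − (p−1) s)^p = δ^{−p}. Then the weight w(t) = t^{s⁻/(1 − p s⁻)} on [0,1] belongs to RH_p^δ([0,1]), and for every t ≥ t*(p,δ) one has ∫_0^1 w(x)^t dx = ∞; in particular, for t ≥ t*(p,δ) there is no finite constant C with ⟨w^t⟩_J^{1/t} ≤ C ⟨w⟩_J holding for all weights in RH_p^δ([0,1]). -/

import Mathlib

open MeasureTheory Set ENNReal

/-- The average `⟨f⟩_{(a,b)}` of an `ℝ≥0∞`-valued function over an interval. -/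
noncomputable def avgE (f : ℝ → ℝ≥0∞) (a b : ℝ) : ℝ≥0∞ :=
  (∫⁻ t in Set.Ioo a b, f t) / ENNReal.ofReal (b - a)

/-- `w ∈ RH_p^δ([A,B])`. -/
def MemRH (p δ A B : ℝ) (w : ℝ → ℝ≥0∞) : Prop :=
  Measurable w ∧ (∫⁻ t in Set.Ioo A B, w t) ≠ ⊤ ∧
    ∀ a b, A ≤ a → a < b → b ≤ B →
      avgE (fun t => w t ^ p) a b ≤ ENNReal.ofReal δ ^ p * (avgE w a b) ^ p

/-- The integral of a power over an interval in `[0, ∞)`, as an extended nonnegative real. -/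
lemma lintegral_Ioo_ofReal_rpow {c a b : ℝ} (hc : -1 < c) (ha : 0 ≤ a) (hab : a < b) :
    ∫⁻ x in Set.Ioo a b, ENNReal.ofReal (x ^ c)
      = ENNReal.ofReal ((b ^ (c + 1) - a ^ (c + 1)) / (c + 1)) := by
  have hint : IntegrableOn (fun x : ℝ => x ^ c) (Set.Ioo a b) :=
    ((intervalIntegral.intervalIntegrable_rpow' hc (a := a) (b := b)).1).mono_set
      Set.Ioo_subset_Ioc_self
  have hnn : 0 ≤ᵐ[volume.restrict (Set.Ioo a b)] fun x : ℝ => x ^ c := by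
    filter_upwards [ae_restrict_mem measurableSet_Ioo] with x hx
    exact Real.rpow_nonneg (ha.trans hx.1.le) c
  rw [← ofReal_integral_eq_lintegral_ofReal hint hnn, ← integral_Ioc_eq_integral_Ioo,
    ← intervalIntegral.integral_of_le hab.le, integral_rpow (Or.inl hc)]

lemma lintegral_Ioo_ofReal_rpow_rpow {c t a b : ℝ} (ha : 0 ≤ a) :
    ∫⁻ x in Set.Ioo a b, ENNReal.ofReal (x ^ c) ^ t
      = ∫⁻ x in Set.Ioo a b, ENNReal.ofReal (x ^ (c * t)) := by
  refine setLIntegral_congr_fun measurableSet_Ioo fun x hx => ?_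
  have hx0 : 0 < x := ha.trans_lt hx.1
  rw [ENNReal.ofReal_rpow_of_pos (Real.rpow_pos_of_pos hx0 c), Real.rpow_mul hx0.le]

lemma lintegral_Ioo_zero_one_ofReal_rpow_eq_top {c : ℝ} (hc : c ≤ -1) :
    ∫⁻ x in Set.Ioo (0 : ℝ) 1, ENNReal.ofReal (x ^ c) = ⊤ := by
  by_contra h
  have hnn : 0 ≤ᵐ[volume.restrict (Set.Ioo (0 : ℝ) 1)] fun x : ℝ => x ^ c := by
    filter_upwards [ae_restrict_mem measurableSet_Ioo] with x hx
    exact Real.rpow_nonneg hx.1.le c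
  have hint : IntegrableOn (fun x : ℝ => x ^ c) (Set.Ioo 0 1) :=
    (lintegral_ofReal_ne_top_iff_integrable (by fun_prop) hnn).1 h
  have := (intervalIntegral.integrableOn_Ioo_rpow_iff zero_lt_one).1 hint
  linarith

/-- Superadditivity of the weighted geometric mean on two points, in normalized form. -/
lemma rpow_mul_rpow_one_sub_le {x y θ : ℝ} (hx : 0 ≤ x) (hx1 : x ≤ 1) (hy : 0 ≤ y) (hy1 : y ≤ 1)
    (hθ : 0 ≤ θ) (hθ1 : θ ≤ 1) :
    (1 - x) ^ θ * (1 - y) ^ (1 - θ) ≤ 1 - x ^ θ * y ^ (1 - θ) := by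
  have h₁ := Real.geom_mean_le_arith_mean2_weighted hθ (sub_nonneg.2 hθ1) hx hy (by ring)
  have h₂ := Real.geom_mean_le_arith_mean2_weighted hθ (sub_nonneg.2 hθ1)
    (sub_nonneg.2 hx1) (sub_nonneg.2 hy1) (by ring)
  linarith

lemma one_sub_rpow_mul_one_sub_rpow_le {r p u v : ℝ} (hp : 1 < p) (hu : 0 < u)
    (hv : v * p = u + (p - 1)) (hr : 0 ≤ r) (hr1 : r ≤ 1) :
    (1 - r ^ u) * (1 - r) ^ (p - 1) ≤ (1 - r ^ v) ^ p := by
  have hp0 : 0 < p := by linarith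
  have hru : r ^ u ≤ 1 := Real.rpow_le_one hr hr1 hu.le
  have hθ : p⁻¹ ≤ 1 := inv_le_one_of_one_le₀ hp.le
  have key := rpow_mul_rpow_one_sub_le (Real.rpow_nonneg hr u) hru hr hr1
    (inv_nonneg.2 hp0.le) hθ
  have hrv : (r ^ u) ^ p⁻¹ * r ^ (1 - p⁻¹) = r ^ v := by
    rw [← Real.rpow_mul hr, ← Real.rpow_add_of_nonneg hr (by positivity) (by linarith)]
    congr 1
    field_simp
    linarith
  rw [hrv] at key
  have h1u : 0 ≤ 1 - r ^ u := by linarith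
  have h1r : 0 ≤ 1 - r := by linarith
  have h := Real.rpow_le_rpow (by positivity) key hp0.le
  rw [Real.mul_rpow (by positivity) (by positivity), ← Real.rpow_mul h1u, ← Real.rpow_mul h1r,
    inv_mul_cancel₀ hp0.ne', Real.rpow_one] at h
  convert h using 3
  field_simp

/-- Homogeneous form of `one_sub_rpow_mul_one_sub_rpow_le`. -/
lemma sub_rpow_mul_sub_rpow_le {a b p u v : ℝ} (hp : 1 < p) (hu : 0 < u)
    (hv : v * p = u + (p - 1)) (ha : 0 ≤ a) (hab : a < b) :
    (b ^ u - a ^ u) * (b - a) ^ (p - 1) ≤ (b ^ v - a ^ v) ^ p := by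
  have hb : 0 < b := ha.trans_lt hab
  have hv0 : 0 < v := by
    by_contra! h
    nlinarith
  obtain ⟨r, hr, hr1, rfl⟩ : ∃ r, 0 ≤ r ∧ r ≤ 1 ∧ a = b * r :=
    ⟨a / b, by positivity, (div_le_one hb).2 hab.le, by field_simp⟩
  have key := one_sub_rpow_mul_one_sub_rpow_le hp hu hv hr hr1
  have h1v : 0 ≤ 1 - r ^ v := sub_nonneg.2 (Real.rpow_le_one hr hr1 hv0.le)
  have e₁ : b ^ u - (b * r) ^ u = b ^ u * (1 - r ^ u) := by
    rw [Real.mul_rpow hb.le hr]; ring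
  have e₂ : b ^ v - (b * r) ^ v = b ^ v * (1 - r ^ v) := by
    rw [Real.mul_rpow hb.le hr]; ring
  have e₃ : b - b * r = b * (1 - r) := by ring
  rw [e₁, e₂, e₃, Real.mul_rpow hb.le (by linarith), Real.mul_rpow (by positivity) h1v,
    ← Real.rpow_mul hb.le, hv, Real.rpow_add hb]
  have : 0 ≤ b ^ u * b ^ (p - 1) := by positivity
  calc b ^ u * (1 - r ^ u) * (b ^ (p - 1) * (1 - r) ^ (p - 1))
      = b ^ u * b ^ (p - 1) * ((1 - r ^ u) * (1 - r) ^ (p - 1)) := by ring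
    _ ≤ _ := mul_le_mul_of_nonneg_left key this

/-- The power weight `x ^ c` with `-1 / p < c < 0` satisfies the reverse Hölder inequality with
constant `δ`, where `δ ^ p = (1 + c) ^ p / (1 + c * p)`. -/
lemma memRH_rpow {p δ c : ℝ} (hp : 1 < p) (hδ : 0 < δ) (hc : -1 < c) (hcp : -1 < c * p)
    (h : δ ^ p * (c * p + 1) = (c + 1) ^ p) :
    MemRH p δ 0 1 (fun x => ENNReal.ofReal (x ^ c)) := by
  have hp0 : 0 < p := by linarith
  have hu : 0 < c * p + 1 := by linarith
  have hv : 0 < c + 1 := by linarith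
  refine ⟨by fun_prop, ?_, fun a b ha hab _ => ?_⟩
  · rw [lintegral_Ioo_ofReal_rpow hc le_rfl zero_lt_one]
    exact ENNReal.ofReal_ne_top
  have hba : 0 < b - a := by linarith
  have hvv : 0 ≤ b ^ (c + 1) - a ^ (c + 1) :=
    sub_nonneg.2 (Real.rpow_le_rpow ha hab.le hv.le)
  unfold avgE
  rw [lintegral_Ioo_ofReal_rpow_rpow ha, lintegral_Ioo_ofReal_rpow hcp ha hab,
    lintegral_Ioo_ofReal_rpow hc ha hab, ← ENNReal.ofReal_div_of_pos hba,
    ← ENNReal.ofReal_div_of_pos hba, ENNReal.ofReal_rpow_of_pos hδ,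
    ENNReal.ofReal_rpow_of_nonneg (by positivity) hp0.le,
    ← ENNReal.ofReal_mul (by positivity)]
  apply ENNReal.ofReal_le_ofReal
  have key := sub_rpow_mul_sub_rpow_le (u := c * p + 1) (v := c + 1) hp hu (by ring) ha hab
  rw [Real.div_rpow (by positivity) hba.le, Real.div_rpow hvv hv.le, ← h]
  have hD : (b - a) ^ p = (b - a) ^ (p - 1) * (b - a) := by
    rw [← Real.rpow_add_one hba.ne']; ring_nf
  rw [hD]
  have hδp : 0 < δ ^ p := by positivity
  have hq : 0 < (b - a) ^ (p - 1) := by positivity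
  calc (b ^ (c * p + 1) - a ^ (c * p + 1)) / (c * p + 1) / (b - a)
      = (b ^ (c * p + 1) - a ^ (c * p + 1)) * (b - a) ^ (p - 1)
          / ((c * p + 1) * ((b - a) ^ (p - 1) * (b - a))) := by field_simp
    _ ≤ (b ^ (c + 1) - a ^ (c + 1)) ^ p / ((c * p + 1) * ((b - a) ^ (p - 1) * (b - a))) := by
        gcongr
    _ = _ := by field_simp

lemma one_sub_mul_div_one_sub_rpow_strictAntiOn {p : ℝ} (hp : 1 < p) :
    StrictAntiOn (fun x : ℝ => (1 - p * x) / (1 - x) ^ p) (Set.Ioo 0 p⁻¹) := by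
  rintro x ⟨hx0, hx⟩ y ⟨hy0, hy⟩ hxy
  have hp0 : 0 < p := by linarith
  have hpx : p * x < 1 := (lt_inv_mul_iff₀ hp0).1 (by rwa [mul_one])
  have hpy : p * y < 1 := (lt_inv_mul_iff₀ hp0).1 (by rwa [mul_one])
  have hx1 : 0 < 1 - x := by nlinarith
  have hy1 : 0 < 1 - y := by nlinarith
  have hpx' : 0 < 1 - p * x := by linarith
  have hB := one_add_mul_self_lt_rpow_one_add (s := (1 - y) / (1 - x) - 1) (p := p)
    (by have : 0 < (1 - y) / (1 - x) := by positivity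
        linarith)
    (by rw [sub_ne_zero, ne_eq, div_eq_one_iff_eq hx1.ne']; intro h; linarith) hp
  rw [add_sub_cancel, Real.div_rpow hy1.le hx1.le] at hB
  have hle : (1 - p * y) / (1 - p * x) ≤ 1 + p * ((1 - y) / (1 - x) - 1) := by
    rw [div_le_iff₀ hpx', ← sub_nonneg]
    have : (1 + p * ((1 - y) / (1 - x) - 1)) * (1 - p * x) - (1 - p * y)
        = p * (y - x) * ((p - 1) * x) / (1 - x) := by
      field_simp
      ring
    rw [this]
    have := sub_pos.2 hxy
    have := sub_pos.2 hp
    positivity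
  have hlt := hle.trans_lt hB
  have h1 : 0 < (1 - x) ^ p := by positivity
  have h2 : 0 < (1 - y) ^ p := by positivity
  simp only
  rw [div_lt_div_iff₀ hpx' h1] at hlt
  rw [div_lt_div_iff₀ h2 h1]
  linarith

theorem statement8 (p δ s ts : ℝ) (hp : 1 < p) (hδ : 1 < δ)
    (hs0 : s < 0)
    (hs : (1 - p * s) ^ (p - 1) / (1 - (p - 1) * s) ^ p = δ ^ (-p))
    (hts1 : p < ts) (hts : (δ * ts / (ts - 1)) ^ p * ((ts - p) / ts) = 1) :
    MemRH p δ 0 1 (fun x => ENNReal.ofReal (x ^ (s / (1 - p * s)))) ∧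
    ∀ t : ℝ, ts ≤ t →
      (∫⁻ x in Set.Ioo (0:ℝ) 1,
          (ENNReal.ofReal (x ^ (s / (1 - p * s)))) ^ t) = ⊤ ∧
      ∀ C : ℝ, ¬ (∀ w : ℝ → ℝ≥0∞, MemRH p δ 0 1 w →
        ∀ a b : ℝ, 0 ≤ a → a < b → b ≤ 1 →
          (avgE (fun x => w x ^ t) a b) ^ (1 / t)
            ≤ ENNReal.ofReal C * avgE w a b) := by
  have hp0 : 0 < p := by linarith
  have hδ0 : 0 < δ := by linarith
  have hts0 : 0 < ts := by linarith
  have hps : 0 < 1 - p * s := by nlinarith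
  have hps' : 0 < 1 - (p - 1) * s := by nlinarith
  set c := s / (1 - p * s) with hc
  have hcneg : c < 0 := div_neg_of_neg_of_pos hs0 hps
  have hu : c * p + 1 = 1 / (1 - p * s) := by rw [hc, div_mul_eq_mul_div, div_add_one hps.ne']; ring_nf
  have hv : c + 1 = (1 - (p - 1) * s) / (1 - p * s) := by rw [hc, div_add_one hps.ne']; ring_nf
  have hu0 : 0 < c * p + 1 := by rw [hu]; positivity
  have hv0 : 0 < c + 1 := by rw [hv]; positivity
  have hδp : 0 < δ ^ p := by positivity
  have hrel : δ ^ p * (c * p + 1) = (c + 1) ^ p := by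
    have hpow : (1 - p * s) ^ p = (1 - p * s) ^ (p - 1) * (1 - p * s) := by
      rw [← Real.rpow_add_one hps.ne']; ring_nf
    have h1 : 0 < (1 - p * s) ^ (p - 1) := by positivity
    have h2 : 0 < (1 - (p - 1) * s) ^ p := by positivity
    rw [Real.rpow_neg hδ0.le, div_eq_iff h2.ne', eq_inv_mul_iff_mul_eq₀ hδp.ne'] at hs
    rw [hu, hv, Real.div_rpow hps'.le hps.le, hpow, ← hs]
    field_simp
  have hcts : -c = ts⁻¹ := by
    have hts1' : 0 < ts - 1 := by linarith
    apply (one_sub_mul_div_one_sub_rpow_strictAntiOn hp).injOn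
    · refine ⟨by linarith, ?_⟩
      rw [← one_div, lt_div_iff₀ hp0]
      linarith
    · exact ⟨by positivity, inv_strictAnti₀ hp0 hts1⟩
    · have e₁ : (1 - p * -c) / (1 - -c) ^ p = (δ ^ p)⁻¹ := by
        have h3 : 0 < (c + 1) ^ p := by positivity
        rw [show 1 - p * -c = c * p + 1 by ring, show 1 - -c = c + 1 by ring,
          div_eq_iff h3.ne', ← hrel]
        field_simp
      have e₂ : (1 - p * ts⁻¹) / (1 - ts⁻¹) ^ p = (δ ^ p)⁻¹ := by
        have h3 : 1 - ts⁻¹ = (ts / (ts - 1))⁻¹ := by field_simp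
        have h4 : 1 - p * ts⁻¹ = (ts - p) / ts := by field_simp
        rw [mul_div_assoc, Real.mul_rpow hδ0.le (by positivity), mul_assoc] at hts
        rw [h3, h4, Real.inv_rpow (by positivity), div_inv_eq_mul, mul_comm]
        exact eq_inv_of_mul_eq_one_right hts
      exact e₁.trans e₂.symm
  have hmem := memRH_rpow hp hδ0 (by linarith) (by linarith) hrel
  refine ⟨hmem, fun t ht => ?_⟩
  have hct : c * t ≤ -1 := by
    have h1 : ts⁻¹ * ts = 1 := inv_mul_cancel₀ hts0.ne'
    rw [← hcts] at h1
    nlinarith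
  have htop : (∫⁻ x in Set.Ioo (0:ℝ) 1, ENNReal.ofReal (x ^ c) ^ t) = ⊤ := by
    rw [lintegral_Ioo_ofReal_rpow_rpow le_rfl, lintegral_Ioo_zero_one_ofReal_rpow_eq_top hct]
  refine ⟨htop, fun C hC => ?_⟩
  have h := hC _ hmem 0 1 le_rfl zero_lt_one le_rfl
  have ht0 : 0 < 1 / t := one_div_pos.2 (by linarith)
  simp only [avgE, htop, sub_zero, ENNReal.ofReal_one, div_one, ENNReal.top_rpow_of_pos ht0,
    top_le_iff] at h
  exact ENNReal.mul_ne_top ENNReal.ofReal_ne_top hmem.2.1 h
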